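/- No deterministic single-sample pricing strategy is better than (1/2)-approximate for regular distributions: for every function p : [0,∞) → [0,∞) and every γ > 1/2, there exists a regular value distribution D with CDF F such that E_{v∼D}[p(v)·(1 − F(p(v)))] < γ · max_r r·(1 − F(r)). -/

import Mathlib

open MeasureTheory Set

/-- A value distribution on `[0,∞)` with CDF `F`, density `f` (w.r.t. Lebesgue measure),
whose support is an interval contained in `[0,∞)`. -/
structure ValueDist where
  μ : Measure ℝ
  isProb : IsProbabilityMeasure μ
  f : ℝ → ℝ
  f_nonneg : ∀ x, 0 ≤ f x
  f_meas : Measurable f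
  density_eq : μ = volume.withDensity fun x => ENNReal.ofReal (f x)
  supp : Set ℝ
  supp_subset : supp ⊆ Ici 0
  supp_conn : supp.OrdConnected
  f_pos : ∀ x ∈ supp, 0 < f x
  f_zero : ∀ x ∉ supp, f x = 0

/-- The CDF of a value distribution. -/
noncomputable def ValueDist.F (D : ValueDist) (x : ℝ) : ℝ := (D.μ (Iic x)).toReal

/-- The virtual value function `φ(v) = v - (1 - F v) / f v`. -/
noncomputable def ValueDist.phi (D : ValueDist) (x : ℝ) : ℝ := x - (1 - D.F x) / D.f x

/-- Monotone hazard rate: the virtual value satisfies `dφ/dv ≥ 1` throughout the support. -/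
def ValueDist.IsMHR (D : ValueDist) : Prop :=
  ∀ x ∈ D.supp, ∃ d : ℝ, 1 ≤ d ∧ HasDerivWithinAt D.phi d D.supp x

/-- Regularity: the virtual value function is nondecreasing on the support. -/
def ValueDist.IsRegular (D : ValueDist) : Prop :=
  ∀ x ∈ D.supp, ∀ y ∈ D.supp, x ≤ y → D.phi x ≤ D.phi y


lemma ssl_integral (D : ValueDist) (g : ℝ → ℝ) : ∫ x, g x ∂D.μ = ∫ x, D.f x * g x := by
  rw [D.density_eq, integral_withDensity_eq_integral_toReal_smul
    (by have := D.f_meas; fun_prop) (by simp)]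
  simp [ENNReal.toReal_ofReal (D.f_nonneg _)]

lemma ssl_tail (D : ValueDist) (x : ℝ) : 1 - D.F x = ∫ y in Ioi x, D.f y := by
  have := D.isProb
  have h1 : 1 - D.F x = D.μ.real (Ioi x) := by
    have := prob_compl_eq_one_sub (μ := D.μ) (measurableSet_Iic (a := x))
    rw [compl_Iic] at this
    rw [ValueDist.F, Measure.real, this, ENNReal.toReal_sub_of_le prob_le_one (by simp)]
    simp
  have h2 : D.μ.real (Ioi x) = ∫ y, (Ioi x).indicator (fun _ => (1:ℝ)) y ∂D.μ := by
    rw [integral_indicator measurableSet_Ioi]; simp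
  rw [h1, h2, ssl_integral, ← integral_indicator measurableSet_Ioi]
  congr 1; ext y
  by_cases hy : y ∈ Ioi x <;> simp [hy]

lemma ssl_F_mono (D : ValueDist) : Monotone D.F := by
  have := D.isProb
  intro x y h
  exact ENNReal.toReal_mono (by simp) (measure_mono (Iic_subset_Iic.2 h))

lemma ssl_F_nonneg (D : ValueDist) (x : ℝ) : 0 ≤ D.F x := ENNReal.toReal_nonneg

lemma ssl_F_le (D : ValueDist) (x : ℝ) : D.F x ≤ 1 := by
  have := D.isProb
  exact measureReal_le_one (μ := D.μ)

lemma ssl_supp (D : ValueDist) (hs : MeasurableSet D.supp) : ∀ᵐ x ∂D.μ, x ∈ D.supp := by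
  rw [D.density_eq, ae_withDensity_iff (by have := D.f_meas; fun_prop)]
  refine Filter.Eventually.of_forall fun x hx => ?_
  by_contra h
  simp [D.f_zero x h] at hx

lemma ssl_ac (D : ValueDist) : D.μ ≪ volume := by
  rw [D.density_eq]; exact withDensity_absolutelyContinuous _ _

noncomputable def sslMk (s : Set ℝ) (g : ℝ → ℝ) (hs : MeasurableSet s) (hg : Measurable g)
    (h0 : s ⊆ Ici 0) (hc : s.OrdConnected) (hpos : ∀ x ∈ s, 0 < g x)
    (hi : IntegrableOn g s) (h1 : ∫ x in s, g x = 1) : ValueDist where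
  μ := volume.withDensity fun x => ENNReal.ofReal (s.indicator g x)
  isProb := by
    constructor
    rw [withDensity_apply _ MeasurableSet.univ, Measure.restrict_univ,
      ← ofReal_integral_eq_lintegral_ofReal ((integrable_indicator_iff hs).2 hi)
      (Filter.Eventually.of_forall (indicator_nonneg fun x hx => (hpos x hx).le)),
      integral_indicator hs, h1, ENNReal.ofReal_one]
  f := s.indicator g
  f_nonneg := indicator_nonneg fun x hx => (hpos x hx).le
  f_meas := hg.indicator hs
  density_eq := rfl
  supp := s
  supp_subset := h0
  supp_conn := hc
  f_pos := fun x hx => by rw [indicator_of_mem hx]; exact hpos x hx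
  f_zero := fun x hx => indicator_of_notMem hx _

lemma ssl_tri_tail (x : ℝ) (hx : 0 ≤ x) : IntegrableOn (fun y : ℝ => ((1 + y)^2)⁻¹) (Ioi x) ∧
    ∫ y in Ioi x, ((1 + y)^2)⁻¹ = 1 / (1 + x) := by
  have hd : ∀ y ∈ Ici x, HasDerivAt (fun y : ℝ => -(1 + y)⁻¹) (((1 + y)^2)⁻¹) y := by
    intro y hy
    have hy : x ≤ y := hy
    have : (1 + y) ≠ 0 := by linarith
    have := (((hasDerivAt_id y).const_add 1).inv this).neg
    refine HasDerivAt.congr_deriv this ?_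
    simp [id, neg_div]
  have ht : Filter.Tendsto (fun y : ℝ => -(1 + y)⁻¹) Filter.atTop (nhds 0) := by
    have := (tendsto_inv_atTop_zero.comp
      (Filter.tendsto_atTop_add_const_left Filter.atTop (1:ℝ) Filter.tendsto_id)).neg
    simpa using this
  refine ⟨integrableOn_Ioi_deriv_of_nonneg' hd (fun y _ => by positivity) ht, ?_⟩
  rw [integral_Ioi_of_hasDerivAt_of_nonneg' hd (fun y _ => by positivity) ht]
  simp

lemma ssl_tri_half : ∫ y in Ioi (0:ℝ), ((1 + y)^2)⁻¹ * (y / (1 + y)) = 1 / 2 := by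
  have hd : ∀ y ∈ Ici (0:ℝ), HasDerivAt (fun y : ℝ => (1 - (1 + y)⁻¹)^2 / 2)
      (((1 + y)^2)⁻¹ * (y / (1 + y))) y := by
    intro y hy
    have hy : 0 ≤ y := hy
    have h : (1 + y) ≠ 0 := by linarith
    have := ((((((hasDerivAt_id y).const_add 1).inv h).const_sub 1).pow 2).div_const 2)
    refine HasDerivAt.congr_deriv this ?_
    simp [id]
    field_simp
    try ring
  have ht : Filter.Tendsto (fun y : ℝ => (1 - (1 + y)⁻¹)^2 / 2) Filter.atTop (nhds (1/2)) := by
    have := (((tendsto_inv_atTop_zero.comp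
      (Filter.tendsto_atTop_add_const_left Filter.atTop (1:ℝ) Filter.tendsto_id)).const_sub 1).pow 2).div_const 2
    simpa using this
  rw [integral_Ioi_of_hasDerivAt_of_nonneg' hd (fun y hy => ?_) ht]
  · simp
  · have : 0 < y := hy
    positivity

noncomputable def sslTri : ValueDist :=
  sslMk (Ici 0) (fun y => ((1 + y)^2)⁻¹) measurableSet_Ici (by fun_prop) subset_rfl
    ordConnected_Ici (fun x hx => by have : 0 ≤ x := hx; positivity)
    (by rw [integrableOn_Ici_iff_integrableOn_Ioi]; exact (ssl_tri_tail 0 le_rfl).1)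
    (by rw [integral_Ici_eq_integral_Ioi, (ssl_tri_tail 0 le_rfl).2]; simp)

lemma sslTri_tail (x : ℝ) (hx : 0 ≤ x) : 1 - sslTri.F x = 1 / (1 + x) := by
  rw [ssl_tail, ← (ssl_tri_tail x hx).2]
  refine setIntegral_congr_fun measurableSet_Ioi fun y hy => ?_
  have hy : x < y := hy
  exact indicator_of_mem (show y ∈ Ici (0:ℝ) from hx.trans hy.le) (fun y : ℝ => ((1 + y)^2)⁻¹)

lemma sslTri_regular : sslTri.IsRegular := by
  have : ∀ x ∈ sslTri.supp, sslTri.phi x = -1 := by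
    intro x hx
    have hx0 : 0 ≤ x := hx
    have hf : sslTri.f x = ((1 + x)^2)⁻¹ :=
      indicator_of_mem (s := Ici (0:ℝ)) hx (fun y : ℝ => ((1 + y)^2)⁻¹)
    rw [ValueDist.phi, sslTri_tail x hx0, hf]
    field_simp
    ring
  intro x hx y hy _
  rw [this x hx, this y hy]

noncomputable def sslUnif (a b : ℝ) (ha : 0 ≤ a) (hab : a < b) : ValueDist :=
  sslMk (Icc a b) (fun _ => (b - a)⁻¹) measurableSet_Icc (by fun_prop)
    (fun x hx => ha.trans hx.1) ordConnected_Icc (fun x hx => inv_pos.2 (sub_pos.2 hab))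
    (by simp)
    (by
      have : b - a ≠ 0 := by linarith
      simp [hab.le, this])

lemma sslUnif_tail (a b : ℝ) (ha : 0 ≤ a) (hab : a < b) (x : ℝ) (hx : x ∈ Icc a b) :
    1 - (sslUnif a b ha hab).F x = (b - x) / (b - a) := by
  rw [ssl_tail]
  change ∫ y in Ioi x, (Icc a b).indicator (fun _ => (b - a)⁻¹) y = _
  rw [setIntegral_indicator measurableSet_Icc]
  have : Ioi x ∩ Icc a b = Ioc x b := by
    ext y; simp only [mem_inter_iff, mem_Ioi, mem_Icc, mem_Ioc]
    constructor
    · rintro ⟨h1, h2, h3⟩; exact ⟨h1, h3⟩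
    · rintro ⟨h1, h2⟩; exact ⟨h1, hx.1.trans h1.le, h2⟩
  rw [this]
  simp [hx.2, div_eq_mul_inv]

lemma sslUnif_regular (a b : ℝ) (ha : 0 ≤ a) (hab : a < b) :
    (sslUnif a b ha hab).IsRegular := by
  have : ∀ x ∈ (sslUnif a b ha hab).supp, (sslUnif a b ha hab).phi x = x - (b - x) := by
    intro x hx
    have hf : (sslUnif a b ha hab).f x = (b - a)⁻¹ :=
      indicator_of_mem (s := Icc a b) hx (fun _ => (b - a)⁻¹)
    have : b - a ≠ 0 := by linarith
    rw [ValueDist.phi, sslUnif_tail a b ha hab x hx, hf]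
    field_simp
  intro x hx y hy _
  rw [this x hx, this y hy]
  linarith

lemma sslUnif_half (a b : ℝ) (ha : 0 ≤ a) (hab : a < b) :
    ∫ x, (1 - (sslUnif a b ha hab).F x) ∂(sslUnif a b ha hab).μ = 1 / 2 := by
  rw [ssl_integral]
  have : ∀ x, (sslUnif a b ha hab).f x * (1 - (sslUnif a b ha hab).F x)
      = (Icc a b).indicator (fun x => (b - a)⁻¹ * ((b - x) / (b - a))) x := by
    intro x
    by_cases hx : x ∈ Icc a b
    · rw [sslUnif_tail a b ha hab x hx, indicator_of_mem hx,
        show (sslUnif a b ha hab).f x = (b - a)⁻¹ from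
          indicator_of_mem (s := Icc a b) hx (fun _ => (b - a)⁻¹)]
    · rw [indicator_of_notMem hx,
        show (sslUnif a b ha hab).f x = 0 from
          indicator_of_notMem (s := Icc a b) hx (fun _ => (b - a)⁻¹), zero_mul]
  simp_rw [this]
  rw [integral_indicator measurableSet_Icc, integral_Icc_eq_integral_Ioc,
    ← intervalIntegral.integral_of_le hab.le]
  have h : b - a ≠ 0 := by linarith
  simp only [intervalIntegral.integral_const_mul, intervalIntegral.integral_div]
  rw [intervalIntegral.integral_sub (by simp) (by simp)]
  simp
  field_simp
  ring

lemma sslUnif_real (a b : ℝ) (ha : 0 ≤ a) (hab : a < b) (A : Set ℝ) (hA : MeasurableSet A) :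
    (sslUnif a b ha hab).μ.real A = volume.real (A ∩ Icc a b) / (b - a) := by
  have h2 : (sslUnif a b ha hab).μ.real A
      = ∫ y, A.indicator (fun _ => (1:ℝ)) y ∂(sslUnif a b ha hab).μ := by
    rw [integral_indicator hA]; simp
  rw [h2, ssl_integral]
  have : ∀ x, (sslUnif a b ha hab).f x * A.indicator (fun _ => (1:ℝ)) x
      = (A ∩ Icc a b).indicator (fun _ => (b - a)⁻¹) x := by
    intro x
    change (Icc a b).indicator (fun _ => (b - a)⁻¹) x * _ = _
    by_cases h1 : x ∈ A <;> by_cases h2 : x ∈ Icc a b <;> simp only [indicator, h1, h2, mem_inter_iff] <;> simp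
  simp_rw [this]
  rw [integral_indicator (hA.inter measurableSet_Icc)]
  simp [div_eq_mul_inv]

lemma sslUnif_rev (p : ℝ → ℝ) (hp : Measurable p) (hp' : ∀ v, 0 ≤ v → 0 ≤ p v)
    (a b : ℝ) (ha : 0 ≤ a) (hab : a < b) :
    ∫ x, p x * (1 - (sslUnif a b ha hab).F (p x)) ∂(sslUnif a b ha hab).μ
      ≤ b / 2 + b * (1 - (sslUnif a b ha hab).μ.real {x | x ≤ p x}) := by
  have hA : MeasurableSet {x | x ≤ p x} := measurableSet_le measurable_id hp
  set D := sslUnif a b ha hab with hD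
  have := D.isProb
  have hb : 0 < b := ha.trans_lt hab
  have hm : Measurable D.F := (ssl_F_mono D).measurable
  have i1 : Integrable (fun x => 1 - D.F x) D.μ := by
    refine Integrable.of_bound (C := 1) (by fun_prop) (Filter.Eventually.of_forall fun x => ?_)
    rw [Real.norm_eq_abs, abs_le]
    constructor <;> linarith [ssl_F_nonneg D x, ssl_F_le D x]
  have i2 : Integrable ({x | x ≤ p x}ᶜ.indicator (fun _ => (1:ℝ))) D.μ :=
    (integrable_const 1).indicator hA.compl
  have e : ∫ x, (b * (1 - D.F x) + b * {x | x ≤ p x}ᶜ.indicator (fun _ => (1:ℝ)) x) ∂D.μ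
      = b / 2 + b * (1 - D.μ.real {x | x ≤ p x}) := by
    rw [integral_add (i1.const_mul b) (i2.const_mul b), integral_const_mul, integral_const_mul,
      sslUnif_half, integral_indicator hA.compl]
    simp [probReal_compl_eq_one_sub hA]
    ring
  rw [← e]
  have hs := ssl_supp D measurableSet_Icc
  refine integral_mono_of_nonneg ?_ ((i1.const_mul b).add (i2.const_mul b)) ?_
  · filter_upwards [hs] with x hx
    exact mul_nonneg (hp' x (D.supp_subset hx)) (by linarith [ssl_F_le D (p x)])
  · filter_upwards [hs] with x hx
    have hx : x ∈ Icc a b := hx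
    have h1 := ssl_F_le D (p x)
    have h2 := ssl_F_le D x
    have h3 := ssl_F_nonneg D (p x)
    have h4 : 0 ≤ {x | x ≤ p x}ᶜ.indicator (fun _ => (1:ℝ)) x :=
      indicator_nonneg (fun _ _ => zero_le_one) _
    have h0 := hp' x (D.supp_subset hx)
    change p x * (1 - D.F (p x)) ≤
      b * (1 - D.F x) + b * {x | x ≤ p x}ᶜ.indicator (fun _ => (1:ℝ)) x
    rcases le_or_gt (p x) b with hpb | hpb
    · by_cases hxA : x ≤ p x
      · have := ssl_F_mono D hxA
        have : p x * (1 - D.F (p x)) ≤ b * (1 - D.F x) := by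
          apply mul_le_mul hpb <;> linarith
        nlinarith
      · rw [indicator_of_mem (show x ∈ {x | x ≤ p x}ᶜ from hxA)]
        nlinarith
    · have hFb : 1 - D.F b = 0 := by
        rw [sslUnif_tail a b ha hab b ⟨hab.le, le_rfl⟩]; simp
      have := ssl_F_mono D hpb.le
      have : 1 - D.F (p x) = 0 := by linarith
      rw [this, mul_zero]
      have := mul_nonneg hb.le h4
      have := mul_nonneg hb.le (sub_nonneg.2 h2)
      linarith

theorem regular_single_sample_lower_bound
    (p : ℝ → ℝ) (hp : Measurable p) (hp' : ∀ v, 0 ≤ v → 0 ≤ p v)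
    (γ : ℝ) (hγ : 1/2 < γ) :
    ∃ D : ValueDist, D.IsRegular ∧
      ∃ r : ℝ, ∫ x, p x * (1 - D.F (p x)) ∂D.μ < γ * (r * (1 - D.F r)) := by
  have hA : MeasurableSet {x | x ≤ p x} := measurableSet_le measurable_id hp
  by_cases hz : ∀ᵐ x, 0 < x → p x < x
  · refine ⟨sslTri, sslTri_regular, ?_⟩
    have := sslTri.isProb
    have key : ∫ x, p x * (1 - sslTri.F (p x)) ∂sslTri.μ ≤ 1 / 2 := by
      have e : ∫ x, x / (1 + x) ∂sslTri.μ = 1 / 2 := by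
        rw [ssl_integral, ← ssl_tri_half, ← integral_Ici_eq_integral_Ioi,
          ← integral_indicator measurableSet_Ici]
        congr 1; ext x
        change (Ici (0:ℝ)).indicator (fun y => ((1 + y)^2)⁻¹) x * _ = _
        by_cases hx : x ∈ Ici (0:ℝ) <;> simp only [indicator, hx] <;> simp
      have hs := ssl_supp sslTri measurableSet_Ici
      rw [← e]
      refine integral_mono_of_nonneg ?_ ?_ ?_
      · filter_upwards [hs] with x hx
        exact mul_nonneg (hp' x hx) (by linarith [ssl_F_le sslTri (p x)])
      · refine Integrable.of_bound (C := 1)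
          (Measurable.aestronglyMeasurable (by fun_prop)) ?_
        filter_upwards [hs] with x hx
        have hx : 0 ≤ x := hx
        rw [Real.norm_eq_abs, abs_of_nonneg (by positivity), div_le_one (by positivity)]
        linarith
      · have h0 : ∀ᵐ x : ℝ, x ≠ 0 := by simp [ae_iff]
        filter_upwards [hs, (ssl_ac sslTri).ae_le hz, (ssl_ac sslTri).ae_le h0] with x hx h1 h2
        have hx : 0 ≤ x := hx
        have h3 := h1 (lt_of_le_of_ne hx (Ne.symm h2))
        have h4 := hp' x hx
        rw [sslTri_tail _ h4, mul_one_div, div_le_div_iff₀ (by positivity) (by positivity)]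
        nlinarith
    have hc : 0 < 2 * γ - 1 := by linarith
    refine ⟨2 / (2 * γ - 1), key.trans_lt ?_⟩
    rw [sslTri_tail _ (by positivity)]
    have : γ * (2 / (2 * γ - 1) * (1 / (1 + 2 / (2 * γ - 1)))) = 2 * γ / (2 * γ + 1) := by
      have h1 : 1 + 2 / (2 * γ - 1) = (2 * γ + 1) / (2 * γ - 1) := by
        rw [eq_div_iff hc.ne', add_mul, div_mul_cancel₀ _ hc.ne']; ring
      have h2 : 2 * γ + 1 ≠ 0 := by linarith
      have h3 := hc.ne'
      rw [h1, one_div_div, div_mul_div_cancel₀ h3]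
      ring
    rw [this, div_lt_div_iff₀ (by norm_num) (by linarith)]
    linarith
  · -- a density point of the set where `x ≤ p x`
    have hden := Besicovitch.ae_tendsto_measure_inter_div (volume : Measure ℝ) {x | x ≤ p x}
    rw [ae_restrict_iff' hA] at hden
    have hex : ∃ x, 0 < x ∧ Filter.Tendsto (fun r => volume ({x | x ≤ p x} ∩ Metric.closedBall x r)
        / volume (Metric.closedBall x r)) (nhdsWithin 0 (Ioi 0)) (nhds 1) := by
      by_contra hcon
      push Not at hcon
      apply hz
      filter_upwards [hden] with x hx h0
      by_contra h
      exact hcon x h0 (hx (not_lt.1 h))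
    obtain ⟨x, hx, ht⟩ := hex
    have ht' := (ENNReal.tendsto_toReal (by simp)).comp ht
    have hid : Filter.Tendsto (fun r : ℝ => r) (nhdsWithin 0 (Ioi 0)) (nhds 0) :=
      Filter.tendsto_id.mono_left nhdsWithin_le_nhds
    have hL := ((hid.const_add x).div_const 2).add ((hid.const_add x).mul (ht'.const_sub 1))
    have hR := (hid.const_sub x).const_mul γ
    have hlt := hL.eventually_lt hR (by simp; nlinarith)
    have hsm : ∀ᶠ r in nhdsWithin (0:ℝ) (Ioi 0), r < x :=
      hid.eventually (gt_mem_nhds hx)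
    obtain ⟨r, ⟨h1, h2⟩, h3⟩ := ((hlt.and hsm).and self_mem_nhdsWithin).exists
    have h3 : 0 < r := h3
    have ha : 0 ≤ x - r := by linarith
    have hab : x - r < x + r := by linarith
    refine ⟨sslUnif (x - r) (x + r) ha hab, sslUnif_regular _ _ _ _, x - r, ?_⟩
    refine (sslUnif_rev p hp hp' _ _ ha hab).trans_lt ?_
    rw [sslUnif_tail _ _ ha hab (x - r) ⟨le_rfl, hab.le⟩, div_self (by linarith), mul_one,
      sslUnif_real _ _ _ _ _ hA]
    convert h1 using 5
    simp only [Function.comp, Real.closedBall_eq_Icc, ENNReal.toReal_div, Real.volume_Icc]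
    rw [ENNReal.toReal_ofReal (by linarith)]
    rfl
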